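/- arXiv:2403.17464 — 3 statements merged into one kernel-verified Lean document; each statement's English description precedes it below -/
import Mathlib

section
/- Let β > 0 be a real number and d ≥ 1. There exist constants 0 < c ≤ C < ∞ depending only on β such that for all real numbers s < t and all φ, ξ ∈ ℝ^d with (φ,ξ) ≠ (0,0), one has c·(t−s)·(|ξ−sφ|^{2β} + ((t−s)|φ|)^{2β}) ≤ ∫_s^t |ξ−τφ|^{2β} dτ ≤ C·(t−s)·(|ξ−sφ|^{2β} + ((t−s)|φ|)^{2β}), and likewise c·(t−s)·(|ξ−tφ|^{2β} + ((t−s)|φ|)^{2β}) ≤ ∫_s^t |ξ−τφ|^{2β} dτ ≤ C·(t−s)·(|ξ−tφ|^{2β} + ((t−s)|φ|)^{2β}). -/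
open MeasureTheory Real

theorem Real.add_rpow_le_two_rpow_mul {x y p : ℝ} (hx : 0 ≤ x) (hy : 0 ≤ y) (hp : 0 ≤ p) :
    (x + y) ^ p ≤ 2 ^ p * (x ^ p + y ^ p) := by
  wlog h : x ≤ y generalizing x y
  · simpa only [add_comm] using this hy hx (le_of_not_ge h)
  calc (x + y) ^ p ≤ (2 * y) ^ p := by gcongr; linarith
    _ = 2 ^ p * y ^ p := mul_rpow zero_le_two hy
    _ ≤ 2 ^ p * (x ^ p + y ^ p) := by
      gcongr
      exact le_add_of_nonneg_left (rpow_nonneg hx p)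

section

variable {E : Type*} [NormedAddCommGroup E] [NormedSpace ℝ E]

theorem norm_rpow_add_norm_rpow_le_of_segment {p u : ℝ} (hp : 0 ≤ p)
    (hu : u ∈ Set.Icc 0 (1 / 2 : ℝ)) (a b : E) :
    ‖a‖ ^ p + ‖b‖ ^ p ≤ 2 * 4 ^ p * (‖a + u • b‖ ^ p + ‖a + (u + 1 / 2) • b‖ ^ p) := by
  obtain ⟨hu0, hu1⟩ := hu
  set x := a + u • b with hx
  set y := a + (u + 1 / 2) • b with hy
  have key (z : E) (hz : ‖z‖ ≤ 2 * (‖x‖ + ‖y‖)) : ‖z‖ ^ p ≤ 4 ^ p * (‖x‖ ^ p + ‖y‖ ^ p) :=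
    calc ‖z‖ ^ p ≤ (2 * (‖x‖ + ‖y‖)) ^ p := by gcongr
      _ = 2 ^ p * (‖x‖ + ‖y‖) ^ p := mul_rpow zero_le_two (by positivity)
      _ ≤ 2 ^ p * (2 ^ p * (‖x‖ ^ p + ‖y‖ ^ p)) := by
        gcongr
        exact add_rpow_le_two_rpow_mul (norm_nonneg _) (norm_nonneg _) hp
      _ = 4 ^ p * (‖x‖ ^ p + ‖y‖ ^ p) := by
        rw [← mul_assoc, ← mul_rpow zero_le_two zero_le_two]
        norm_num
  have ha : ‖a‖ ≤ 2 * (‖x‖ + ‖y‖) := by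
    have h : a = (2 * u + 1) • x - (2 * u) • y := by rw [hx, hy]; module
    calc ‖a‖ ≤ ‖(2 * u + 1) • x‖ + ‖(2 * u) • y‖ := by
          conv_lhs => rw [h]
          exact norm_sub_le _ _
      _ = (2 * u + 1) * ‖x‖ + (2 * u) * ‖y‖ := by
          rw [norm_smul_of_nonneg (by linarith), norm_smul_of_nonneg (by linarith)]
      _ ≤ 2 * ‖x‖ + 2 * ‖y‖ := by gcongr <;> linarith
      _ = 2 * (‖x‖ + ‖y‖) := by ring
  have hb : ‖b‖ ≤ 2 * (‖x‖ + ‖y‖) := by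
    have h : b = (2 : ℝ) • (y - x) := by rw [hx, hy]; module
    calc ‖b‖ = 2 * ‖y - x‖ := by
          conv_lhs => rw [h]
          exact norm_smul_of_nonneg zero_le_two _
      _ ≤ 2 * (‖x‖ + ‖y‖) := by
          rw [add_comm]
          gcongr
          exact norm_sub_le _ _
  linarith [key a ha, key b hb]

theorem le_integral_norm_add_smul_rpow {p : ℝ} (hp : 0 ≤ p) (a b : E) :
    (4 * 4 ^ p)⁻¹ * (‖a‖ ^ p + ‖b‖ ^ p) ≤ ∫ u in (0 : ℝ)..1, ‖a + u • b‖ ^ p := by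
  have hf : Continuous fun u : ℝ ↦ ‖a + u • b‖ ^ p :=
    Continuous.rpow_const (by fun_prop) fun _ ↦ Or.inr hp
  have hg : Continuous fun u : ℝ ↦ ‖a + (u + 1 / 2) • b‖ ^ p :=
    hf.comp (continuous_id.add continuous_const)
  have hsplit : ∫ u in (0 : ℝ)..1, ‖a + u • b‖ ^ p =
      ∫ u in (0 : ℝ)..(1 / 2), (‖a + u • b‖ ^ p + ‖a + (u + 1 / 2) • b‖ ^ p) := by
    rw [intervalIntegral.integral_add (hf.intervalIntegrable _ _) (hg.intervalIntegrable _ _),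
      intervalIntegral.integral_comp_add_right (fun u : ℝ ↦ ‖a + u • b‖ ^ p) (1 / 2),
      zero_add, add_halves, intervalIntegral.integral_add_adjacent_intervals
        (hf.intervalIntegrable _ _) (hf.intervalIntegrable _ _)]
  have hmono := intervalIntegral.integral_mono_on (μ := volume) (a := (0 : ℝ)) (b := 1 / 2) (by norm_num)
    (intervalIntegrable_const (c := ‖a‖ ^ p + ‖b‖ ^ p))
    (((hf.add hg).const_mul (2 * 4 ^ p)).intervalIntegrable _ _)
    fun u hu ↦ norm_rpow_add_norm_rpow_le_of_segment hp hu a b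
  rw [intervalIntegral.integral_const, intervalIntegral.integral_const_mul,
    smul_eq_mul] at hmono
  simp only [Pi.add_apply, ← hsplit] at hmono
  rw [inv_mul_le_iff₀ (by positivity)]
  linarith

theorem integral_norm_add_smul_rpow_le {p : ℝ} (hp : 0 ≤ p) (a b : E) :
    ∫ u in (0 : ℝ)..1, ‖a + u • b‖ ^ p ≤ 2 ^ p * (‖a‖ ^ p + ‖b‖ ^ p) := by
  have hf : Continuous fun u : ℝ ↦ ‖a + u • b‖ ^ p :=
    Continuous.rpow_const (by fun_prop) fun _ ↦ Or.inr hp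
  have hmono := intervalIntegral.integral_mono_on (μ := volume) (a := (0 : ℝ)) (b := 1) zero_le_one
    (hf.intervalIntegrable _ _)
    (intervalIntegrable_const (c := 2 ^ p * (‖a‖ ^ p + ‖b‖ ^ p))) fun u hu ↦ by
      refine le_trans ?_ (add_rpow_le_two_rpow_mul (norm_nonneg a) (norm_nonneg b) hp)
      gcongr
      refine (norm_add_le _ _).trans ?_
      rw [norm_smul_of_nonneg hu.1]
      gcongr
      exact mul_le_of_le_one_left (norm_nonneg b) hu.2
  simpa using hmono

end

/-- Lemma 2.11 (comparison of the Kolmogorov exponent): for `β > 0` there are constants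
`0 < c ≤ C < ∞` depending only on `β` such that for all `s < t` and `(φ, ξ) ≠ (0, 0)` in
`ℝ^d × ℝ^d`, the integral `∫_s^t ‖ξ - τφ‖^{2β} dτ` is comparable to
`(t - s)(‖ξ - sφ‖^{2β} + ((t - s)‖φ‖)^{2β})` and to
`(t - s)(‖ξ - tφ‖^{2β} + ((t - s)‖φ‖)^{2β})`. -/
theorem kolmogorov_exponent_comparison (β : ℝ) (hβ : 0 < β) :
    ∃ c C : ℝ, 0 < c ∧ c ≤ C ∧
      ∀ (d : ℕ), 1 ≤ d → ∀ s t : ℝ, s < t →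
        ∀ φ ξ : EuclideanSpace ℝ (Fin d), (φ, ξ) ≠ (0, 0) →
          (c * ((t - s) * (‖ξ - s • φ‖ ^ (2 * β) + ((t - s) * ‖φ‖) ^ (2 * β)))
              ≤ (∫ τ in s..t, ‖ξ - τ • φ‖ ^ (2 * β)) ∧
            (∫ τ in s..t, ‖ξ - τ • φ‖ ^ (2 * β))
              ≤ C * ((t - s) * (‖ξ - s • φ‖ ^ (2 * β) + ((t - s) * ‖φ‖) ^ (2 * β)))) ∧
          (c * ((t - s) * (‖ξ - t • φ‖ ^ (2 * β) + ((t - s) * ‖φ‖) ^ (2 * β)))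
              ≤ (∫ τ in s..t, ‖ξ - τ • φ‖ ^ (2 * β)) ∧
            (∫ τ in s..t, ‖ξ - τ • φ‖ ^ (2 * β))
              ≤ C * ((t - s) * (‖ξ - t • φ‖ ^ (2 * β) + ((t - s) * ‖φ‖) ^ (2 * β)))) := by
  have hp : 0 ≤ 2 * β := by positivity
  have h4 : (1 : ℝ) ≤ 4 ^ (2 * β) := one_le_rpow (by norm_num) hp
  refine ⟨(4 * 4 ^ (2 * β))⁻¹, 2 ^ (2 * β), by positivity,
    (inv_le_one_of_one_le₀ (by linarith)).trans (one_le_rpow one_le_two hp), ?_⟩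
  intro d _ s t hst φ ξ _
  have hts : 0 < t - s := sub_pos.2 hst
  have hnorm : ‖(t - s) • φ‖ = (t - s) * ‖φ‖ := norm_smul_of_nonneg hts.le φ
  have hleft : ∫ τ in s..t, ‖ξ - τ • φ‖ ^ (2 * β) =
      (t - s) * ∫ u in (0 : ℝ)..1, ‖(ξ - s • φ) + u • -((t - s) • φ)‖ ^ (2 * β) := by
    have h := intervalIntegral.smul_integral_comp_add_mul (a := 0) (b := 1)
      (fun τ : ℝ ↦ ‖ξ - τ • φ‖ ^ (2 * β)) (t - s) s
    rw [mul_zero, mul_one, add_zero, add_sub_cancel, smul_eq_mul] at h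
    rw [← h]
    congr! 5 with u
    module
  have hright : ∫ τ in s..t, ‖ξ - τ • φ‖ ^ (2 * β) =
      (t - s) * ∫ u in (0 : ℝ)..1, ‖(ξ - t • φ) + u • ((t - s) • φ)‖ ^ (2 * β) := by
    have h := intervalIntegral.smul_integral_comp_sub_mul (a := 0) (b := 1)
      (fun τ : ℝ ↦ ‖ξ - τ • φ‖ ^ (2 * β)) (t - s) t
    rw [mul_zero, mul_one, sub_zero, sub_sub_cancel, smul_eq_mul] at h
    rw [← h]
    congr! 5 with u
    module
  constructor
  · rw [hleft, ← hnorm, ← norm_neg ((t - s) • φ), mul_left_comm, mul_left_comm (2 ^ (2 * β))]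
    exact ⟨mul_le_mul_of_nonneg_left (le_integral_norm_add_smul_rpow hp _ _) hts.le,
      mul_le_mul_of_nonneg_left (integral_norm_add_smul_rpow_le hp _ _) hts.le⟩
  · rw [hright, ← hnorm, mul_left_comm, mul_left_comm (2 ^ (2 * β))]
    exact ⟨mul_le_mul_of_nonneg_left (le_integral_norm_add_smul_rpow hp _ _) hts.le,
      mul_le_mul_of_nonneg_left (integral_norm_add_smul_rpow_le hp _ _) hts.le⟩
end

section
/- Let β > 0 and c > 0 be real numbers. There exist constants 0 < c₁ ≤ C₁ < ∞ depending only on c and β such that for all real A, B ≥ 0 with (A,B) ≠ (0,0), one has c₁·(max(B, A^{1/(1+2β)}))^{−2β} ≤ ∫_0^∞ e^{−c u^{1+2β} A^{2β}} · e^{−c u B^{2β}} du ≤ C₁·(max(B, A^{1/(1+2β)}))^{−2β}. -/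
open MeasureTheory Real

/-- The integrand decays at the exponential rate given by the larger of the two scales. -/
lemma exp_mul_exp_le_exp_max {p c T Y u : ℝ} (hp : 1 ≤ p) (hc : 0 < c) (hT : 0 ≤ T)
    (hY : 0 ≤ Y) (hu : 0 ≤ u) :
    exp (-(c * (u * T) ^ p)) * exp (-(c * u * Y)) ≤ exp c * exp (-(c * max Y T) * u) := by
  have huT : 0 ≤ u * T := mul_nonneg hu hT
  have huY : 0 ≤ u * Y := mul_nonneg hu hY
  have hpow : 0 ≤ (u * T) ^ p := rpow_nonneg huT p
  have hpow_ge : u * T - 1 ≤ (u * T) ^ p := by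
    rcases le_total (u * T) 1 with h | h
    · linarith
    · linarith [self_le_rpow_of_one_le h hp]
  rw [← exp_add, ← exp_add, exp_le_exp]
  rcases max_cases Y T with ⟨h, _⟩ | ⟨h, _⟩ <;> rw [h] <;>
    nlinarith [mul_nonneg hc.le hpow, mul_nonneg hc.le huY,
      mul_le_mul_of_nonneg_left hpow_ge hc.le]

lemma integrableOn_exp_mul_exp {p c T Y : ℝ} (hp : 1 ≤ p) (hc : 0 < c) (hT : 0 ≤ T)
    (hY : 0 ≤ Y) (hS : 0 < max Y T) :
    IntegrableOn (fun u : ℝ => exp (-(c * (u * T) ^ p)) * exp (-(c * u * Y)))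
      (Set.Ioi 0) := by
  refine Integrable.mono' ((exp_neg_integrableOn_Ioi 0 (mul_pos hc hS)).const_mul (exp c))
    (by fun_prop) ?_
  filter_upwards [ae_restrict_mem measurableSet_Ioi] with u hu
  rw [norm_of_nonneg (by positivity)]
  exact exp_mul_exp_le_exp_max hp hc hT hY (le_of_lt hu)

lemma setIntegral_exp_mul_exp_le {p c T Y : ℝ} (hp : 1 ≤ p) (hc : 0 < c) (hT : 0 ≤ T)
    (hY : 0 ≤ Y) (hS : 0 < max Y T) :
    ∫ u in Set.Ioi (0 : ℝ), exp (-(c * (u * T) ^ p)) * exp (-(c * u * Y))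
      ≤ exp c / c * (max Y T)⁻¹ := by
  have hcS := mul_pos hc hS
  calc _ ≤ ∫ u in Set.Ioi (0 : ℝ), exp c * exp (-(c * max Y T) * u) :=
        setIntegral_mono_on (integrableOn_exp_mul_exp hp hc hT hY hS)
          ((exp_neg_integrableOn_Ioi 0 hcS).const_mul (exp c)) measurableSet_Ioi
          fun u hu => exp_mul_exp_le_exp_max hp hc hT hY (le_of_lt hu)
    _ = exp c / c * (max Y T)⁻¹ := by
        rw [integral_const_mul, integral_exp_mul_Ioi (neg_neg_of_pos hcS)]
        simp only [mul_zero, exp_zero]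
        field_simp

lemma le_setIntegral_exp_mul_exp {p c T Y : ℝ} (hp : 1 ≤ p) (hc : 0 < c) (hT : 0 ≤ T)
    (hY : 0 ≤ Y) (hS : 0 < max Y T) :
    exp (-(2 * c)) * (max Y T)⁻¹
      ≤ ∫ u in Set.Ioi (0 : ℝ), exp (-(c * (u * T) ^ p)) * exp (-(c * u * Y)) := by
  have hint := integrableOn_exp_mul_exp hp hc hT hY hS
  have hsub : Set.Ioc 0 (max Y T)⁻¹ ⊆ Set.Ioi (0 : ℝ) := Set.Ioc_subset_Ioi_self
  calc exp (-(2 * c)) * (max Y T)⁻¹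
      = ∫ _ in Set.Ioc 0 (max Y T)⁻¹, exp (-(2 * c)) := by
        rw [setIntegral_const, volume_real_Ioc_of_le (by positivity), smul_eq_mul]
        ring
    _ ≤ ∫ u in Set.Ioc 0 (max Y T)⁻¹, exp (-(c * (u * T) ^ p)) * exp (-(c * u * Y)) := by
        refine setIntegral_mono_on (integrableOn_const measure_Ioc_lt_top.ne)
          (hint.mono_set hsub) measurableSet_Ioc fun u hu => ?_
        have huS : u * max Y T ≤ 1 := (le_inv_mul_iff₀' hS).1 (by simpa using hu.2)
        have huT : u * T ≤ 1 :=
          (mul_le_mul_of_nonneg_left (le_max_right Y T) hu.1.le).trans huS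
        have huY : u * Y ≤ 1 :=
          (mul_le_mul_of_nonneg_left (le_max_left Y T) hu.1.le).trans huS
        have hpow : (u * T) ^ p ≤ 1 :=
          rpow_le_one (mul_nonneg hu.1.le hT) huT (by linarith)
        rw [← exp_add, exp_le_exp]
        nlinarith
    _ ≤ _ := setIntegral_mono_set hint (ae_of_all _ fun u => by positivity)
        hsub.eventuallyLE

/-- Equation (2.19): for `β > 0` and `c > 0` there are constants `0 < c₁ ≤ C₁ < ∞`
depending only on `c` and `β` such that for all `A, B ≥ 0` with `(A, B) ≠ (0, 0)`,
`∫_0^∞ e^{-c u^{1+2β} A^{2β}} e^{-c u B^{2β}} du ≃ (max(B, A^{1/(1+2β)}))^{-2β}`. -/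
theorem exponential_integral_comparison (β c : ℝ) (hβ : 0 < β) (hc : 0 < c) :
    ∃ c₁ C₁ : ℝ, 0 < c₁ ∧ c₁ ≤ C₁ ∧
      ∀ A B : ℝ, 0 ≤ A → 0 ≤ B → (A, B) ≠ (0, 0) →
        c₁ * (max B (A ^ (1 / (1 + 2 * β)))) ^ (-(2 * β))
            ≤ (∫ u in Set.Ioi (0 : ℝ),
                Real.exp (-(c * u ^ (1 + 2 * β) * A ^ (2 * β))) *
                  Real.exp (-(c * u * B ^ (2 * β)))) ∧
          (∫ u in Set.Ioi (0 : ℝ),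
              Real.exp (-(c * u ^ (1 + 2 * β) * A ^ (2 * β))) *
                Real.exp (-(c * u * B ^ (2 * β))))
            ≤ C₁ * (max B (A ^ (1 / (1 + 2 * β)))) ^ (-(2 * β)) := by
  have hp : 0 < 1 + 2 * β := by positivity
  refine ⟨exp (-(2 * c)), exp c / c, exp_pos _, ?_, fun A B hA hB hAB => ?_⟩
  · rw [le_div_iff₀ hc]
    have hexp : exp (-(2 * c)) ≤ 1 := exp_le_one_iff.2 (by linarith)
    nlinarith [add_one_le_exp c]
  set T := (A ^ (1 / (1 + 2 * β))) ^ (2 * β) with hTdef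
  have hA' : 0 ≤ A ^ (1 / (1 + 2 * β)) := rpow_nonneg hA _
  have hT : 0 ≤ T := rpow_nonneg hA' _
  have hY : 0 ≤ B ^ (2 * β) := rpow_nonneg hB _
  have hTpow : T ^ (1 + 2 * β) = A ^ (2 * β) := by
    rw [hTdef, ← rpow_mul hA', ← rpow_mul hA]
    congr 1
    field_simp
  have hmax : 0 < max B (A ^ (1 / (1 + 2 * β))) := by
    rcases hA.eq_or_lt with rfl | hA
    · exact lt_max_of_lt_left (hB.lt_of_ne fun h => hAB (by rw [← h]))
    · exact lt_max_of_lt_right (rpow_pos_of_pos hA _)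
  have hmax_rpow :
      (max B (A ^ (1 / (1 + 2 * β)))) ^ (2 * β) = max (B ^ (2 * β)) T :=
    (monotoneOn_rpow_Ici_of_exponent_nonneg (by positivity)).map_max hB hA'
  have hS : 0 < max (B ^ (2 * β)) T := hmax_rpow ▸ rpow_pos_of_pos hmax _
  have hcongr : (∫ u in Set.Ioi (0 : ℝ),
      exp (-(c * u ^ (1 + 2 * β) * A ^ (2 * β))) * exp (-(c * u * B ^ (2 * β)))) =
      ∫ u in Set.Ioi (0 : ℝ),
        exp (-(c * (u * T) ^ (1 + 2 * β))) * exp (-(c * u * B ^ (2 * β))) :=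
    setIntegral_congr_fun measurableSet_Ioi fun u hu => by
      simp only [mul_rpow (le_of_lt hu) hT, hTpow, mul_assoc]
  rw [hcongr, rpow_neg hmax.le, hmax_rpow]
  exact ⟨le_setIntegral_exp_mul_exp (by linarith) hc hT hY hS,
    setIntegral_exp_mul_exp_le (by linarith) hc hT hY hS⟩
end

section
/- Let β > 0, α > 0 and d ≥ 1. There exist constants 0 < c ≤ C < ∞ depending only on β and α such that for all φ, ξ ∈ ℝ^d with (φ,ξ) ≠ (0,0) and all t ∈ ℝ, one has c·W(t,φ,ξ)^{−2β} ≤ ∫_{−∞}^t K(t,s,φ,ξ)^α ds ≤ C·W(t,φ,ξ)^{−2β}. -/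
open MeasureTheory Real

/-- The weight `W(t,φ,ξ) = max(‖ξ - tφ‖, ‖φ‖^{1/(1+2β)})`. -/
noncomputable def Wgt (β : ℝ) {d : ℕ} (t : ℝ) (φ ξ : EuclideanSpace ℝ (Fin d)) : ℝ :=
  max ‖ξ - t • φ‖ (‖φ‖ ^ (1 / (1 + 2 * β)))

/-- The Kolmogorov kernel `K(t,s,φ,ξ) = exp(-∫_s^t ‖ξ - τφ‖^{2β} dτ)`. -/
noncomputable def Kker (β : ℝ) {d : ℕ} (t s : ℝ) (φ ξ : EuclideanSpace ℝ (Fin d)) : ℝ :=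
  Real.exp (-(∫ τ in s..t, ‖ξ - τ • φ‖ ^ (2 * β)))

open intervalIntegral in
/-- If a nonnegative `g` cannot be small at both `u` and `2u` once `R ≤ u`, then its primitive
grows at least linearly. -/
theorem le_integral_of_le_add_comp_two_mul {g : ℝ → ℝ} (hg : Continuous g) (hg0 : ∀ u, 0 ≤ g u)
    {m R r : ℝ} (hm : 0 ≤ m) (hR : 0 ≤ R) (hr : 0 ≤ r)
    (h : ∀ u, R ≤ u → m ≤ g u + g (2 * u)) :
    m * ((r - 2 * R) / 3) ≤ ∫ u in (0 : ℝ)..r, g u := by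
  have hnn : ∀ a b : ℝ, a ≤ b → 0 ≤ ∫ u in a..b, g u := fun a b hab =>
    integral_nonneg hab fun u _ => hg0 u
  have hint : ∀ a b : ℝ, IntervalIntegrable g volume a b := hg.intervalIntegrable
  have hg2 : Continuous fun u => g (2 * u) := by fun_prop
  rcases le_total r (2 * R) with hrR | hrR
  · have : m * ((r - 2 * R) / 3) ≤ 0 := mul_nonpos_of_nonneg_of_nonpos hm (by linarith)
    exact this.trans (hnn 0 r hr)
  · have h1 : ∫ _ in R..(r / 2), m ≤ ∫ u in R..(r / 2), (g u + g (2 * u)) :=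
      integral_mono_on (by linarith) intervalIntegrable_const
        ((hg.add hg2).intervalIntegrable _ _) fun u hu => h u hu.1
    rw [intervalIntegral.integral_const, smul_eq_mul,
      integral_add (hint _ _) (hg2.intervalIntegrable _ _),
      integral_comp_mul_left g two_ne_zero, smul_eq_mul, mul_div_cancel₀ r two_ne_zero] at h1
    have e1 := integral_add_adjacent_intervals (hint 0 R) (hint R (r / 2))
    have e2 := integral_add_adjacent_intervals (hint 0 (r / 2)) (hint (r / 2) r)
    have e3 := integral_add_adjacent_intervals (hint 0 (2 * R)) (hint (2 * R) r)
    have n1 := hnn 0 R hR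
    have n2 := hnn (r / 2) r (by linarith)
    have n3 := hnn 0 (2 * R) (by linarith)
    linarith

section Line

variable {E : Type*} [NormedAddCommGroup E] [NormedSpace ℝ E]

theorem continuous_norm_sub_smul_rpow {p : ℝ} (hp : 0 ≤ p) (x v : E) :
    Continuous fun τ : ℝ => ‖x - τ • v‖ ^ p :=
  Continuous.rpow_const (by fun_prop) fun _ => Or.inr hp

theorem norm_add_smul_le_two_mul {y v : E} {w R u : ℝ} (hy : ‖y‖ ≤ w) (hv : R * ‖v‖ ≤ w)
    (hu0 : 0 ≤ u) (hu : u ≤ R) : ‖y + u • v‖ ≤ 2 * w := by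
  have h1 := norm_add_le y (u • v)
  rw [norm_smul, Real.norm_of_nonneg hu0] at h1
  have h2 : u * ‖v‖ ≤ R * ‖v‖ := by gcongr
  linarith

theorem div_three_le_max_norm_add_smul {y v : E} {w R u : ℝ} (h : w ≤ ‖y‖ ∨ w ≤ R * ‖v‖)
    (hR : 0 ≤ R) (hu : R ≤ u) :
    w / 3 ≤ max ‖y + u • v‖ ‖y + (2 * u) • v‖ := by
  have hl := le_max_left ‖y + u • v‖ ‖y + (2 * u) • v‖
  have hr := le_max_right ‖y + u • v‖ ‖y + (2 * u) • v‖
  have h0 := (norm_nonneg _).trans hl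
  rcases h with h | h
  · have e : y = (2 : ℝ) • (y + u • v) - (y + (2 * u) • v) := by module
    have h1 := norm_sub_le ((2 : ℝ) • (y + u • v)) (y + (2 * u) • v)
    rw [← e, norm_smul, Real.norm_of_nonneg zero_le_two] at h1
    linarith
  · have e : u • v = (y + (2 * u) • v) - (y + u • v) := by module
    have h1 := norm_sub_le (y + (2 * u) • v) (y + u • v)
    rw [← e, norm_smul, Real.norm_of_nonneg (hR.trans hu)] at h1
    have h2 : R * ‖v‖ ≤ u * ‖v‖ := by gcongr
    linarith

theorem rpow_div_three_le_add {p : ℝ} (hp : 0 ≤ p) {y v : E} {w R u : ℝ} (hw : 0 ≤ w)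
    (h : w ≤ ‖y‖ ∨ w ≤ R * ‖v‖) (hR : 0 ≤ R) (hu : R ≤ u) :
    (w / 3) ^ p ≤ ‖y + u • v‖ ^ p + ‖y + (2 * u) • v‖ ^ p := by
  have h1 : 0 ≤ ‖y + u • v‖ ^ p := by positivity
  have h2 : 0 ≤ ‖y + (2 * u) • v‖ ^ p := by positivity
  rcases le_max_iff.1 (div_three_le_max_norm_add_smul h hR hu) with h3 | h3
  · have := Real.rpow_le_rpow (by positivity) h3 hp
    linarith
  · have := Real.rpow_le_rpow (by positivity) h3 hp
    linarith

end Line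

section Kernel

variable {β : ℝ} {d : ℕ} {t : ℝ} {φ ξ : EuclideanSpace ℝ (Fin d)}

theorem Wgt_pos (h : (φ, ξ) ≠ (0, 0)) : 0 < Wgt β t φ ξ := by
  unfold Wgt
  by_cases hφ : φ = 0
  · have hξ : ξ ≠ 0 := by
      rintro rfl
      exact h (by rw [hφ])
    exact lt_max_of_lt_left (by simpa [hφ] using hξ)
  · exact lt_max_of_lt_right (Real.rpow_pos_of_pos (norm_pos_iff.2 hφ) _)

theorem norm_sub_smul_le_Wgt : ‖ξ - t • φ‖ ≤ Wgt β t φ ξ := le_max_left _ _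

theorem rpow_neg_mul_norm_le_Wgt (hβ : 0 < β) (h : (φ, ξ) ≠ (0, 0)) :
    Wgt β t φ ξ ^ (-(2 * β)) * ‖φ‖ ≤ Wgt β t φ ξ := by
  have hW := Wgt_pos (β := β) (t := t) h
  have h1 : ‖φ‖ ≤ Wgt β t φ ξ ^ (1 + 2 * β) := by
    rw [← Real.rpow_inv_le_iff_of_pos (norm_nonneg _) hW.le (by positivity), ← one_div]
    exact le_max_right _ _
  calc Wgt β t φ ξ ^ (-(2 * β)) * ‖φ‖
      ≤ Wgt β t φ ξ ^ (-(2 * β)) * Wgt β t φ ξ ^ (1 + 2 * β) := by gcongr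
    _ = Wgt β t φ ξ := by
      rw [← Real.rpow_add hW, neg_add_cancel_comm_assoc, Real.rpow_one]

theorem Wgt_le_norm_or (hβ : 0 < β) (h : (φ, ξ) ≠ (0, 0)) :
    Wgt β t φ ξ ≤ ‖ξ - t • φ‖ ∨ Wgt β t φ ξ ≤ Wgt β t φ ξ ^ (-(2 * β)) * ‖φ‖ := by
  have hW := Wgt_pos (β := β) (t := t) h
  rcases max_choice ‖ξ - t • φ‖ (‖φ‖ ^ (1 / (1 + 2 * β))) with h1 | h1
  · exact Or.inl h1.le
  · right
    have h2 : Wgt β t φ ξ = ‖φ‖ ^ (1 + 2 * β)⁻¹ := by rw [← one_div]; exact h1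
    have h3 : Wgt β t φ ξ ^ (1 + 2 * β) = ‖φ‖ := by
      rw [h2, Real.rpow_inv_rpow (norm_nonneg _) (by positivity)]
    rw [← h3, ← Real.rpow_add hW, neg_add_cancel_comm_assoc, Real.rpow_one]

theorem integral_norm_sub_smul_rpow (s : ℝ) :
    ∫ τ in s..t, ‖ξ - τ • φ‖ ^ (2 * β) =
      ∫ u in (0 : ℝ)..(t - s), ‖(ξ - t • φ) + u • φ‖ ^ (2 * β) := by
  have h := intervalIntegral.integral_comp_sub_left (a := s) (b := t)
    (fun u : ℝ => ‖(ξ - t • φ) + u • φ‖ ^ (2 * β)) t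
  rw [sub_self] at h
  rw [← h]
  refine intervalIntegral.integral_congr fun τ _ => ?_
  have : ξ - τ • φ = (ξ - t • φ) + (t - τ) • φ := by module
  simp only [this]

theorem continuous_Kker (hβ : 0 ≤ β) : Continuous fun s => Kker β t s φ ξ := by
  have hc := continuous_norm_sub_smul_rpow (p := 2 * β) (by positivity) ξ φ
  simp only [Kker, intervalIntegral.integral_symm t]
  exact Real.continuous_exp.comp
    (intervalIntegral.continuous_primitive hc.intervalIntegrable t).neg.neg

theorem continuous_Kker_rpow (hβ : 0 ≤ β) (α : ℝ) : Continuous fun s => Kker β t s φ ξ ^ α :=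
  (continuous_Kker hβ).rpow_const fun _ => Or.inl (Real.exp_ne_zero _)

theorem Kker_rpow_nonneg (s α : ℝ) : 0 ≤ Kker β t s φ ξ ^ α :=
  Real.rpow_nonneg (Real.exp_pos _).le _

theorem Kker_rpow (s α : ℝ) :
    Kker β t s φ ξ ^ α =
      Real.exp (-α * ∫ u in (0 : ℝ)..(t - s), ‖(ξ - t • φ) + u • φ‖ ^ (2 * β)) := by
  rw [Kker, integral_norm_sub_smul_rpow, ← Real.exp_mul]
  ring_nf

theorem Kker_rpow_le (hβ : 0 < β) {α : ℝ} (hα : 0 < α) (h : (φ, ξ) ≠ (0, 0)) {s : ℝ}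
    (hs : s ≤ t) :
    Kker β t s φ ξ ^ α ≤
      Real.exp (2 * α / 3 / 3 ^ (2 * β) - α * (Wgt β t φ ξ / 3) ^ (2 * β) / 3 * t) *
        Real.exp (α * (Wgt β t φ ξ / 3) ^ (2 * β) / 3 * s) := by
  have hW := Wgt_pos (β := β) (t := t) h
  have key := le_integral_of_le_add_comp_two_mul
    (g := fun u : ℝ => ‖(ξ - t • φ) + u • φ‖ ^ (2 * β)) (m := (Wgt β t φ ξ / 3) ^ (2 * β))
    (R := Wgt β t φ ξ ^ (-(2 * β))) (r := t - s)
    (Continuous.rpow_const (by fun_prop) fun _ => Or.inr (by positivity))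
    (fun u => by positivity) (by positivity) (by positivity) (sub_nonneg.2 hs)
    fun u hu => rpow_div_three_le_add (by positivity) hW.le (Wgt_le_norm_or hβ h)
      (by positivity) hu
  have hmR : (Wgt β t φ ξ / 3) ^ (2 * β) * Wgt β t φ ξ ^ (-(2 * β)) = 1 / 3 ^ (2 * β) := by
    rw [Real.div_rpow hW.le (by positivity), Real.rpow_neg hW.le]
    have := (Real.rpow_pos_of_pos hW (2 * β)).ne'
    field_simp
  rw [Kker_rpow, ← Real.exp_add, Real.exp_le_exp]
  calc _ ≤ -α * ((Wgt β t φ ξ / 3) ^ (2 * β) * ((t - s - 2 * Wgt β t φ ξ ^ (-(2 * β))) / 3)) :=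
        mul_le_mul_of_nonpos_left key (by linarith)
    _ = 2 * α / 3 * ((Wgt β t φ ξ / 3) ^ (2 * β) * Wgt β t φ ξ ^ (-(2 * β)))
          - α * (Wgt β t φ ξ / 3) ^ (2 * β) / 3 * t
          + α * (Wgt β t φ ξ / 3) ^ (2 * β) / 3 * s := by ring
    _ = _ := by rw [hmR, mul_one_div]

theorem le_Kker_rpow (hβ : 0 < β) {α : ℝ} (hα : 0 < α) (h : (φ, ξ) ≠ (0, 0)) {s : ℝ}
    (hs : s ∈ Set.Ioc (t - Wgt β t φ ξ ^ (-(2 * β))) t) :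
    Real.exp (-α * 2 ^ (2 * β)) ≤ Kker β t s φ ξ ^ α := by
  have hW := Wgt_pos (β := β) (t := t) h
  rw [Kker_rpow, Real.exp_le_exp]
  refine mul_le_mul_of_nonpos_left ?_ (by linarith)
  have hle : ∫ u in (0 : ℝ)..(t - s), ‖(ξ - t • φ) + u • φ‖ ^ (2 * β) ≤
      ∫ _ in (0 : ℝ)..(t - s), (2 * Wgt β t φ ξ) ^ (2 * β) := by
    refine intervalIntegral.integral_mono_on (by linarith [hs.2]) ?_ intervalIntegrable_const
      fun u hu => ?_
    · exact (Continuous.rpow_const (by fun_prop)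
        fun _ => Or.inr (by positivity)).intervalIntegrable _ _
    · exact Real.rpow_le_rpow (norm_nonneg _) (norm_add_smul_le_two_mul norm_sub_smul_le_Wgt
        (rpow_neg_mul_norm_le_Wgt hβ h) hu.1 (by linarith [hs.1, hu.2])) (by positivity)
  rw [intervalIntegral.integral_const, smul_eq_mul, sub_zero] at hle
  calc _ ≤ _ := hle
    _ ≤ Wgt β t φ ξ ^ (-(2 * β)) * (2 * Wgt β t φ ξ) ^ (2 * β) := by
      gcongr
      linarith [hs.1]
    _ = 2 ^ (2 * β) := by
      rw [Real.mul_rpow zero_le_two hW.le, Real.rpow_neg hW.le]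
      have := (Real.rpow_pos_of_pos hW (2 * β)).ne'
      field_simp

theorem integrableOn_Kker_rpow (hβ : 0 < β) {α : ℝ} (hα : 0 < α) (h : (φ, ξ) ≠ (0, 0)) :
    IntegrableOn (fun s => Kker β t s φ ξ ^ α) (Set.Iic t) := by
  have hW := Wgt_pos (β := β) (t := t) h
  refine ((integrableOn_exp_mul_Iic (a := α * (Wgt β t φ ξ / 3) ^ (2 * β) / 3) (by positivity)
    t).const_mul (Real.exp (2 * α / 3 / 3 ^ (2 * β) -
      α * (Wgt β t φ ξ / 3) ^ (2 * β) / 3 * t))).mono' (continuous_Kker_rpow hβ.le α).aestronglyMeasurable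
      ((ae_restrict_iff' measurableSet_Iic).2 (Filter.Eventually.of_forall fun s hs => ?_))
  rw [Real.norm_of_nonneg (Kker_rpow_nonneg s α)]
  exact Kker_rpow_le hβ hα h hs

theorem integral_Kker_rpow_le (hβ : 0 < β) {α : ℝ} (hα : 0 < α) (h : (φ, ξ) ≠ (0, 0)) :
    ∫ s in Set.Iic t, Kker β t s φ ξ ^ α ≤
      Real.exp (2 * α / 3 / 3 ^ (2 * β)) * (3 * 3 ^ (2 * β) / α) *
        Wgt β t φ ξ ^ (-(2 * β)) := by
  have hW := Wgt_pos (β := β) (t := t) h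
  have hk : 0 < α * (Wgt β t φ ξ / 3) ^ (2 * β) / 3 := by positivity
  refine (setIntegral_mono_on (integrableOn_Kker_rpow hβ hα h)
    ((integrableOn_exp_mul_Iic hk t).const_mul _) measurableSet_Iic
    fun s hs => Kker_rpow_le hβ hα h hs).trans_eq ?_
  rw [integral_const_mul, integral_exp_mul_Iic hk, ← mul_div_assoc, ← Real.exp_add,
    sub_add_cancel, Real.div_rpow hW.le (by positivity), Real.rpow_neg hW.le]
  have := (Real.rpow_pos_of_pos hW (2 * β)).ne'
  field_simp

theorem le_integral_Kker_rpow (hβ : 0 < β) {α : ℝ} (hα : 0 < α) (h : (φ, ξ) ≠ (0, 0)) :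
    Real.exp (-α * 2 ^ (2 * β)) * Wgt β t φ ξ ^ (-(2 * β)) ≤
      ∫ s in Set.Iic t, Kker β t s φ ξ ^ α := by
  have hW := Wgt_pos (β := β) (t := t) h
  have hint := integrableOn_Kker_rpow (t := t) hβ hα h
  have h1 := setIntegral_ge_of_const_le measurableSet_Ioc (by simp)
    (fun s hs => le_Kker_rpow hβ hα h hs) (hint.mono_set Set.Ioc_subset_Iic_self)
  rw [Real.volume_real_Ioc_of_le (by linarith [Real.rpow_pos_of_pos hW (-(2 * β))]),
    sub_sub_cancel, smul_eq_mul, mul_comm] at h1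
  exact h1.trans (setIntegral_mono_set hint
    (Filter.Eventually.of_forall fun s => Kker_rpow_nonneg s α)
    Set.Ioc_subset_Iic_self.eventuallyLE)

end Kernel

/-- Estimate (2.12): `∫_{-∞}^t K(t,s,φ,ξ)^α ds ≃ W(t,φ,ξ)^{-2β}` with constants depending
only on `β` and `α`. -/
theorem kernel_integral_in_s_comparison (β α : ℝ) (hβ : 0 < β) (hα : 0 < α) :
    ∃ c C : ℝ, 0 < c ∧ c ≤ C ∧
      ∀ (d : ℕ), 1 ≤ d → ∀ φ ξ : EuclideanSpace ℝ (Fin d), (φ, ξ) ≠ (0, 0) →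
        ∀ t : ℝ,
          c * Wgt β t φ ξ ^ (-(2 * β)) ≤ (∫ s in Set.Iic t, Kker β t s φ ξ ^ α) ∧
          (∫ s in Set.Iic t, Kker β t s φ ξ ^ α) ≤ C * Wgt β t φ ξ ^ (-(2 * β)) := by
  refine ⟨Real.exp (-α * 2 ^ (2 * β)),
    max (Real.exp (-α * 2 ^ (2 * β)))
      (Real.exp (2 * α / 3 / 3 ^ (2 * β)) * (3 * 3 ^ (2 * β) / α)),
    Real.exp_pos _, le_max_left _ _, fun d _ φ ξ h t => ⟨le_integral_Kker_rpow hβ hα h, ?_⟩⟩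
  have hW := Wgt_pos (β := β) (t := t) h
  refine (integral_Kker_rpow_le hβ hα h).trans ?_
  gcongr
  exact le_max_right _ _
end
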